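/- arXiv:2006.06241 — 2 statements merged into one kernel-verified Lean document; each statement's English description precedes it below -/
import Mathlib

section
/- Let λ and μ be partitions, let τ ≥ 0 and k be integers with 0 ≤ k ≤ μ_1, and let [M'; L'] = θ_k(λ, μ) (the ε = − construction). Then for every bipartition [M''; L''] belonging to Θ^{−,τ}_k(λ, μ) and for every s ≥ 1 and t ≥ 1 one has M''_1 + M''_2 + ⋯ + M''_s ≥ M'_1 + M'_2 + ⋯ + M'_s and L''_1 + L''_2 + ⋯ + L''_t ≥ L'_1 + L'_2 + ⋯ + L'_t. -/
/-- The weakly decreasing rearrangement of a weakly decreasing sequence `f`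
with one extra part `t` inserted. -/
def insertPart (t : ℕ) (f : ℕ → ℕ) : ℕ → ℕ
  | 0 => max (f 0) t
  | n + 1 => max (min (f n) t) (f (n + 1))

/-- A partition: a weakly decreasing sequence of naturals with
finitely many nonzero terms. -/
def IsPartition (f : ℕ → ℕ) : Prop := Antitone f ∧ ∃ N, ∀ n, N ≤ n → f n = 0

/-- The size `‖f‖` of a partition: the sum of its parts. -/
noncomputable def psize (f : ℕ → ℕ) : ℕ := ∑ᶠ n, f n

/-- Membership of the bipartition `[M; L]` in `Θ^{+,τ}_k(λ,μ)`:
`M_i ≥ μ_i ≥ M_{i+1}`, `λ_i ≥ L_i ≥ λ_{i+1}` for all `i`, with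
`‖M‖ = ‖μ‖ + τ + k` and `‖L‖ = ‖λ‖ - k`.  (All sequences are 0-indexed.) -/
def ThetaPlusMem (τ k : ℕ) (lam mu M L : ℕ → ℕ) : Prop :=
  IsPartition M ∧ IsPartition L ∧
  (∀ i, mu i ≤ M i ∧ M (i + 1) ≤ mu i) ∧
  (∀ i, L i ≤ lam i ∧ lam (i + 1) ≤ L i) ∧
  psize M = psize mu + τ + k ∧ psize L + k = psize lam

/-- Membership of the bipartition `[M; L]` in `Θ^{-,τ}_k(λ,μ)`:
`μ_i ≥ M_i ≥ μ_{i+1}`, `L_i ≥ λ_i ≥ L_{i+1}` for all `i`, with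
`‖M‖ = ‖μ‖ - k` and `‖L‖ = ‖λ‖ + τ + k`.  (All sequences are 0-indexed.) -/
def ThetaMinusMem (τ k : ℕ) (lam mu M L : ℕ → ℕ) : Prop :=
  IsPartition M ∧ IsPartition L ∧
  (∀ i, M i ≤ mu i ∧ mu (i + 1) ≤ M i) ∧
  (∀ i, lam i ≤ L i ∧ L (i + 1) ≤ lam i) ∧
  psize M + k = psize mu ∧ psize L = psize lam + τ + k

/-- Lexicographic order on sequences: `f` strictly precedes `g`. -/
def LexLt (f g : ℕ → ℕ) : Prop := ∃ i, (∀ j, j < i → f j = g j) ∧ f i < g i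

/-- The size of a sequence vanishing from `N` on is any partial sum with at least `N` terms. -/
lemma psize_eq_sum_range {f : ℕ → ℕ} {N n : ℕ} (hf : ∀ m, N ≤ m → f m = 0)
    (hn : N ≤ n) : psize f = ∑ i ∈ Finset.range n, f i := by
  refine finsum_eq_sum_of_support_subset f fun i hi => ?_
  by_contra h
  exact hi (hf i (by simp at h; omega))

lemma IsPartition.tail {f : ℕ → ℕ} (hf : IsPartition f) :
    IsPartition fun n => f (n + 1) := by
  obtain ⟨ha, N, hN⟩ := hf
  exact ⟨fun a b hab => ha (by omega), N, fun n hn => hN _ (by omega)⟩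

lemma IsPartition.psize_eq_head_add_tail {f : ℕ → ℕ} (hf : IsPartition f) :
    psize f = f 0 + psize fun n => f (n + 1) := by
  obtain ⟨-, N, hN⟩ := hf
  rw [psize_eq_sum_range hN (Nat.le_succ N), Finset.sum_range_succ',
    psize_eq_sum_range (N := N) (n := N) (fun m hm => hN _ (by omega)) le_rfl, add_comm]

lemma sum_range_succ_insertPart {f : ℕ → ℕ} (hf : Antitone f) (t n : ℕ) :
    ∑ i ∈ Finset.range (n + 1), insertPart t f i =
      ∑ i ∈ Finset.range n, f i + max (f n) t := by
  induction n with
  | zero => simp [insertPart]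
  | succ n ih =>
    have : f (n + 1) ≤ f n := hf (Nat.le_succ n)
    rw [Finset.sum_range_succ, ih, Finset.sum_range_succ f n, insertPart]
    omega

/-- Among the partitions of size `‖f‖ + t` interlacing `f` from above, the one obtained by
inserting the part `t` has minimal partial sums. -/
lemma sum_range_insertPart_le {f g : ℕ → ℕ} {t : ℕ} (hf : IsPartition f) (hg : IsPartition g)
    (hfg : ∀ i, f i ≤ g i) (hgf : ∀ i, g (i + 1) ≤ f i) (hsize : psize g = psize f + t) (s : ℕ) :
    ∑ i ∈ Finset.range s, insertPart t f i ≤ ∑ i ∈ Finset.range s, g i := by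
  obtain ⟨hanti, A, hA⟩ := hf
  obtain ⟨-, B, hB⟩ := hg
  have key : ∀ n, ∑ i ∈ Finset.range n, f i + t ≤ ∑ i ∈ Finset.range (n + 1), g i := by
    intro n
    have hlarge : ∑ i ∈ Finset.range (max n (max A B)), f i + t ≤
        ∑ i ∈ Finset.range (max n (max A B) + 1), g i := by
      rw [← psize_eq_sum_range hA (by omega),
        ← psize_eq_sum_range hB (by omega), hsize]
    refine Nat.decreasingInduction (n := max n (max A B))
      (motive := fun m _ => ∑ i ∈ Finset.range m, f i + t ≤ ∑ i ∈ Finset.range (m + 1), g i)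
      (fun m _ ih => ?_) hlarge (le_max_left _ _)
    rw [Finset.sum_range_succ, Finset.sum_range_succ g (m + 1)] at ih
    have := hgf m
    omega
  cases s with
  | zero => simp
  | succ n =>
    rw [sum_range_succ_insertPart hanti, ← max_add_add_left, ← Finset.sum_range_succ]
    exact max_le (Finset.sum_le_sum fun i _ => hfg i) (key n)

/-- Lemma 0418, case ε = -: the bipartition `θ_k(λ,μ)` has minimal partial sums
in both rows among all members of `Θ^{-,τ}_k(λ,μ)`. -/
theorem stmt1 (τ k : ℕ) (lam mu : ℕ → ℕ)
    (hlam : IsPartition lam) (hmu : IsPartition mu) (hk : k ≤ mu 0)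
    (M' L' : ℕ → ℕ)
    (hM' : M' = insertPart (mu 0 - k) fun n => mu (n + 1))
    (hL' : L' = insertPart (τ + k) lam)
    (M'' L'' : ℕ → ℕ) (hmem : ThetaMinusMem τ k lam mu M'' L'') :
    (∀ s : ℕ, ∑ i ∈ Finset.range s, M' i ≤ ∑ i ∈ Finset.range s, M'' i) ∧
    (∀ t : ℕ, ∑ i ∈ Finset.range t, L' i ≤ ∑ i ∈ Finset.range t, L'' i) := by
  obtain ⟨hM, hL, hMmu, hLlam, hMsize, hLsize⟩ := hmem
  subst hM' hL'
  have hhead := hmu.psize_eq_head_add_tail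
  exact ⟨sum_range_insertPart_le hmu.tail hM (fun i => (hMmu i).2) (fun i => (hMmu (i + 1)).1)
      (by omega),
    sum_range_insertPart_le hlam hL (fun i => (hLlam i).1) (fun i => (hLlam i).2) (by omega)⟩
end

section
/- Let λ_1 ≥ λ_2 ≥ ⋯ ≥ λ_m ≥ 0 be natural numbers. For each integer k with 0 ≤ k ≤ λ_1, let J(k) be the weakly decreasing rearrangement of the list (λ_2, …, λ_m, λ_1 − k), and define the strictly decreasing sequence ρ(k) of length m by ρ(k)_p = J(k)_p + (m − p). Then for every k with 0 ≤ k < λ_1 there is exactly one index q(k) ∈ {1, …, m} such that ρ(k+1)_{q(k)} = ρ(k)_{q(k)} − 1 while ρ(k+1)_p = ρ(k)_p for all p ≠ q(k); moreover, setting β(k) = ρ(k)_{q(k)}, the sequence k ↦ β(k) is strictly decreasing. -/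
theorem insertPart_antitone {f : ℕ → ℕ} (hf : Antitone f) (t : ℕ) :
    Antitone (insertPart t f) := by
  refine antitone_nat_of_succ_le fun n => ?_
  have h := hf n.le_succ
  cases n with
  | zero => simp only [insertPart]; grind
  | succ n =>
    have h' := hf n.le_succ
    simp only [insertPart]
    grind

/-- The inserted part sits at the position `i` equal to the number of parts that are at least
as large. -/
theorem insertPart_eq_self {f : ℕ → ℕ} {t i : ℕ} (hi : f i ≤ t)
    (hlt : ∀ j < i, t ≤ f j) : insertPart t f i = t := by
  cases i with
  | zero => simp only [insertPart]; omega
  | succ n =>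
    have h := hlt n n.lt_succ_self
    simp only [insertPart]
    omega

/-- Lowering the inserted part by one only affects the last position holding it. -/
theorem insertPart_succ_eq_of_ne {f : ℕ → ℕ} (hf : Antitone f) {t i p : ℕ} (hi : f i ≤ t)
    (hlt : ∀ j < i, t + 1 ≤ f j) (hp : p ≠ i) : insertPart t f p = insertPart (t + 1) f p := by
  rcases lt_or_gt_of_ne hp with h | h
  · have h₁ := hlt p h
    cases p with
    | zero => simp only [insertPart]; omega
    | succ n =>
      simp only [insertPart]
      omega
  · obtain ⟨n, rfl⟩ : ∃ n, p = n + 1 := ⟨p - 1, by omega⟩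
    have h₁ := hf (Nat.le_of_lt_succ h)
    simp only [insertPart]
    omega

/-- Second-row mechanism: passing from the insertion of `λ_1 - k` to the
insertion of `λ_1 - (k+1)` into `(λ_2, …, λ_m)`, exactly one entry of the
associated strictly decreasing sequence `ρ(k)` (0-indexed,
`ρ(k)_p = J(k)_p + (m - 1 - p)` for `0 ≤ p < m`) decreases by `1`, all others
are unchanged, and the changed values form a strictly decreasing sequence
in `k`. -/
theorem stmt5 (m : ℕ) (hm : 1 ≤ m) (lam : ℕ → ℕ)
    (hlam : ∀ p q, p ≤ q → q < m → lam q ≤ lam p)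
    (hlam0 : ∀ p, m ≤ p → lam p = 0)
    (ρ : ℕ → ℕ → ℕ)
    (hρ : ∀ k p, ρ k p = insertPart (lam 0 - k) (fun n => lam (n + 1)) p + (m - 1 - p)) :
    (∀ k p q, k ≤ lam 0 → p < q → q < m → ρ k q < ρ k p) ∧
    ∃ idx : ℕ → ℕ, (∀ k, k < lam 0 → idx k < m) ∧
      (∀ k, k < lam 0 → ρ (k + 1) (idx k) + 1 = ρ k (idx k)) ∧
      (∀ k p, k < lam 0 → p < m → p ≠ idx k → ρ (k + 1) p = ρ k p) ∧
      (∀ k k', k < k' → k' < lam 0 → ρ k' (idx k') < ρ k (idx k)) := by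
  have hanti : Antitone lam := by
    intro p q hpq
    rcases lt_or_ge q m with hq | hq
    · exact hlam p q hpq hq
    · simp [hlam0 q hq]
  have hf : Antitone fun n => lam (n + 1) := fun a b hab => hanti (Nat.succ_le_succ hab)
  refine ⟨fun k p q _ hpq hq => ?_, ?_⟩
  · have h := insertPart_antitone hf (lam 0 - k) hpq.le
    rw [hρ, hρ]
    omega
  have hex : ∀ k, ∃ i, k < lam 0 →
      i < m ∧ lam (i + 1) < lam 0 - k ∧ ∀ j < i, lam 0 - k ≤ lam (j + 1) := by
    classical
    intro k
    by_cases hk : k < lam 0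
    · have hlast : lam (m - 1 + 1) < lam 0 - k := by
        rw [hlam0 _ (by omega)]
        omega
      have h : ∃ i, lam (i + 1) < lam 0 - k := ⟨m - 1, hlast⟩
      refine ⟨Nat.find h, fun _ => ⟨?_, Nat.find_spec h, fun j hj => ?_⟩⟩
      · have := Nat.find_min' h hlast
        omega
      · exact not_lt.mp (Nat.find_min h hj)
    · exact ⟨0, fun h => absurd h hk⟩
  choose idx hidx using hex
  have hval : ∀ k, k < lam 0 → ρ k (idx k) = lam 0 - k + (m - 1 - idx k) := by
    intro k hk
    obtain ⟨-, h₁, h₂⟩ := hidx k hk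
    rw [hρ, insertPart_eq_self (f := fun n => lam (n + 1)) h₁.le h₂]
  refine ⟨idx, fun k hk => (hidx k hk).1, fun k hk => ?_, fun k p hk _ hp => ?_,
    fun k k' hkk hk' => ?_⟩
  · obtain ⟨-, h₁, h₂⟩ := hidx k hk
    rw [hval k hk, hρ, insertPart_eq_self (f := fun n => lam (n + 1)) (by grind) (by grind)]
    omega
  · obtain ⟨-, h₁, h₂⟩ := hidx k hk
    have ht : lam 0 - k = lam 0 - (k + 1) + 1 := by omega
    rw [ht] at h₁ h₂
    rw [hρ, hρ, ht, insertPart_succ_eq_of_ne hf (Nat.le_of_lt_succ h₁) h₂ hp]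
  · have hk : k < lam 0 := hkk.trans hk'
    have hle : idx k ≤ idx k' := by
      by_contra! h
      have h₁ := (hidx k hk).2.2 _ h
      have h₂ := (hidx k' hk').2.1
      omega
    rw [hval k hk, hval k' hk']
    omega
end
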